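/- arXiv:2002.07871 — 2 statements merged into one kernel-verified Lean document; each statement's English description precedes it below -/
import Mathlib

section
/- Cancellation (zigzag) lemma: Let (C, d) be a based chain complex over ℚ with distinguished finite bases B_n of each C_n. Suppose x ∈ B_n and y ∈ B_{n−1} are basis elements such that the coefficient (d x)_y of y in d x equals 1. Let P denote the linear projection that deletes the x- and y-coordinates (with respect to the distinguished bases), let C′_m be the span of B_m \ {x, y}, and define d′ : C′_m → C′_{m−1} on each basis element a ∈ B_m \ {x, y} by d′(a) = P( d a − (d a)_y · d x ). Then (C′, d′) is a chain complex, and (C, d) is chain homotopy equivalent to (C′, d′). -/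
noncomputable section

/- A based chain complex over `ℚ` is given by a family `B : ℤ → Type` of finite basis sets,
with chain groups `C m = B m →₀ ℚ` and differentials `d m : C (m+1) →ₗ[ℚ] C m`
satisfying `d ∘ d = 0`.  For `v : B m →₀ ℚ` and `b : B m`, the coefficient `v_b` is `v b`. -/

variable (B : ℤ → Type)
variable (d : ∀ m : ℤ, (B (m + 1) →₀ ℚ) →ₗ[ℚ] (B m →₀ ℚ))
variable (n : ℤ)

/-- Cast of basis elements along an equality of degrees. -/
def bcast {a b : ℤ} (h : a = b) : B a → B b := fun t => cast (congrArg B h) t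

/-- Cast of chain groups along an equality of degrees. -/
def fcast {a b : ℤ} (h : a = b) : (B a →₀ ℚ) →ₗ[ℚ] (B b →₀ ℚ) :=
  Finsupp.lmapDomain ℚ ℚ (bcast B h)

variable (x : B (n + 1)) (y : B n)

/-- The basis of the cancelled complex: all distinguished basis elements except `x` and `y`. -/
def Bc (m : ℤ) : Type :=
  {b : B m // (∀ h : m = n + 1, bcast B h b ≠ x) ∧ (∀ h : m = n, bcast B h b ≠ y)}

/-- The inclusion `C′_m → C_m` induced by `B_m \ {x, y} ⊆ B_m`. -/
def incl (m : ℤ) : (Bc B n x y m →₀ ℚ) →ₗ[ℚ] (B m →₀ ℚ) :=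
  Finsupp.lmapDomain ℚ ℚ Subtype.val

/-- The projection `P : C_m → C′_m` deleting the `x`- and `y`-coordinates. -/
def proj (m : ℤ) : (B m →₀ ℚ) →ₗ[ℚ] (Bc B n x y m →₀ ℚ) :=
  Finsupp.lcomapDomain Subtype.val Subtype.val_injective

/-- The coefficient of `y` (interpreted as `0` in degrees other than that of `y`). -/
def coefY (m : ℤ) : (B m →₀ ℚ) →ₗ[ℚ] ℚ :=
  if h : m = n then (Finsupp.lapply y).comp (fcast B h) else 0

/-- The vector `d x`, placed in degree `m` (zero in other degrees). -/
def dxAt (m : ℤ) : B m →₀ ℚ :=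
  if h : m = n then fcast B h.symm (d n (Finsupp.single x 1)) else 0

/-- The differential of the cancelled complex: `d′(a) = P (d a − (d a)_y • d x)`. -/
def d' (m : ℤ) : (Bc B n x y (m + 1) →₀ ℚ) →ₗ[ℚ] (Bc B n x y m →₀ ℚ) :=
  (proj B n x y m).comp
    (((d m).comp (incl B n x y (m + 1))) -
      (LinearMap.toSpanSingleton ℚ _ (dxAt B d n x m)).comp
        ((coefY B n y m).comp ((d m).comp (incl B n x y (m + 1)))))

variable {B d n x y}

@[simp]
lemma fcast_rfl (v : B n →₀ ℚ) : fcast B (rfl : n = n) v = v :=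
  Finsupp.mapDomain_id

variable (B n x) in
/-- The basis vector `x`, placed in degree `m` (zero in other degrees). -/
def xAt (m : ℤ) : B m →₀ ℚ :=
  if h : m = n + 1 then fcast B h.symm (Finsupp.single x 1) else 0

variable (B n x) in
/-- The coefficient of `x` (interpreted as `0` in degrees other than that of `x`). -/
def coefX (m : ℤ) : (B m →₀ ℚ) →ₗ[ℚ] ℚ :=
  if h : m = n + 1 then (Finsupp.lapply x).comp (fcast B h) else 0

variable (B d n y) in
/-- The functional `v ↦ (d v)_y` (zero in degrees other than that of `x`). -/
def coefYd (m : ℤ) : (B m →₀ ℚ) →ₗ[ℚ] ℚ :=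
  if h : m = n + 1 then (Finsupp.lapply y).comp ((d n).comp (fcast B h)) else 0

lemma d_xAt (m : ℤ) : d m (xAt B n x (m + 1)) = dxAt B d n x m := by
  by_cases h : m = n
  · subst h; simp [xAt, dxAt]
  · simp [xAt, dxAt, h]

lemma coefYd_succ (m : ℤ) (v : B (m + 1) →₀ ℚ) :
    coefYd B d n y (m + 1) v = coefY B n y m (d m v) := by
  by_cases h : m = n
  · subst h; simp [coefYd, coefY]
  · simp [coefYd, coefY, h]

lemma coefYd_d (hd : ∀ m : ℤ, (d m).comp (d (m + 1)) = 0) (m : ℤ) (v : B (m + 1) →₀ ℚ) :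
    coefYd B d n y m (d m v) = 0 := by
  by_cases h : m = n + 1
  · subst h
    have := LinearMap.congr_fun (hd n) v
    simp only [LinearMap.comp_apply, LinearMap.zero_apply] at this
    simp [coefYd, this]
  · simp [coefYd, h]

lemma coefY_dxAt_smul_dxAt (hxy : d n (Finsupp.single x 1) y = 1) (m : ℤ) :
    coefY B n y m (dxAt B d n x m) • dxAt B d n x m = dxAt B d n x m := by
  by_cases h : m = n
  · subst h; simp [coefY, dxAt, hxy]
  · simp [dxAt, h]

lemma coefYd_xAt_smul_xAt (hxy : d n (Finsupp.single x 1) y = 1) (m : ℤ) :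
    coefYd B d n y m (xAt B n x m) • xAt B n x m = xAt B n x m := by
  by_cases h : m = n + 1
  · subst h; simp [coefYd, xAt, hxy]
  · simp [xAt, h]

lemma coefY_xAt (m : ℤ) : coefY B n y m (xAt B n x m) = 0 := by
  by_cases h : m = n
  · subst h; simp [xAt]
  · simp [coefY, h]

lemma coefY_incl (m : ℤ) (v : Bc B n x y m →₀ ℚ) : coefY B n y m (incl B n x y m v) = 0 := by
  by_cases h : m = n
  · subst h
    simp only [coefY, incl, dite_true, LinearMap.comp_apply, fcast_rfl, Finsupp.lapply_apply]
    refine Finsupp.mapDomain_of_notMem_range _ _ ?_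
    rintro ⟨b, hb⟩
    exact b.2.2 rfl hb
  · simp [coefY, h]

lemma proj_incl (m : ℤ) (v : Bc B n x y m →₀ ℚ) : proj B n x y m (incl B n x y m v) = v := by
  ext b
  exact Finsupp.mapDomain_apply Subtype.val_injective v b

lemma proj_xAt (m : ℤ) : proj B n x y m (xAt B n x m) = 0 := by
  by_cases h : m = n + 1
  · subst h
    ext b
    simp only [xAt, dite_true, fcast_rfl]
    exact Finsupp.single_eq_of_ne (b.2.1 rfl)
  · simp [xAt, h]

lemma incl_proj_apply_of_mem (m : ℤ) (v : B m →₀ ℚ) (b : Bc B n x y m) :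
    incl B n x y m (proj B n x y m v) b.1 = v b.1 :=
  Finsupp.mapDomain_apply Subtype.val_injective _ b

lemma incl_proj_apply_of_notMem (m : ℤ) (v : B m →₀ ℚ) (b : B m)
    (hb : ¬((∀ h : m = n + 1, bcast B h b ≠ x) ∧ (∀ h : m = n, bcast B h b ≠ y))) :
    incl B n x y m (proj B n x y m v) b = 0 := by
  refine Finsupp.mapDomain_of_notMem_range _ _ ?_
  rintro ⟨c, rfl⟩
  exact hb c.2

variable (B d n x y) in
/-- The homotopy equivalence `v ↦ P (v - v_y • d x)` onto the cancelled complex. -/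
def toCancelled (m : ℤ) : (B m →₀ ℚ) →ₗ[ℚ] (Bc B n x y m →₀ ℚ) :=
  (proj B n x y m).comp
    (LinearMap.id - (LinearMap.toSpanSingleton ℚ _ (dxAt B d n x m)).comp (coefY B n y m))

variable (B d n x y) in
/-- The homotopy equivalence `a ↦ a - (d a)_y • x` from the cancelled complex. -/
def ofCancelled (m : ℤ) : (Bc B n x y m →₀ ℚ) →ₗ[ℚ] (B m →₀ ℚ) :=
  (LinearMap.id - (LinearMap.toSpanSingleton ℚ _ (xAt B n x m)).comp (coefYd B d n y m)).comp
    (incl B n x y m)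

lemma toCancelled_apply (m : ℤ) (v : B m →₀ ℚ) :
    toCancelled B d n x y m v =
      proj B n x y m (v - coefY B n y m v • dxAt B d n x m) := rfl

lemma ofCancelled_apply (m : ℤ) (v : Bc B n x y m →₀ ℚ) :
    ofCancelled B d n x y m v =
      incl B n x y m v - coefYd B d n y m (incl B n x y m v) • xAt B n x m := rfl

lemma d'_apply (m : ℤ) (v : Bc B n x y (m + 1) →₀ ℚ) :
    d' B d n x y m v = toCancelled B d n x y m (d m (incl B n x y (m + 1) v)) := rfl

lemma incl_toCancelled (hxy : d n (Finsupp.single x 1) y = 1) (m : ℤ) (v : B m →₀ ℚ) :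
    incl B n x y m (toCancelled B d n x y m v) =
      v - coefY B n y m v • dxAt B d n x m - coefX B n x m v • xAt B n x m := by
  ext b
  by_cases hb : (∀ h : m = n + 1, bcast B h b ≠ x) ∧ (∀ h : m = n, bcast B h b ≠ y)
  · have hx : xAt B n x m b = 0 := by
      by_cases h : m = n + 1
      · subst h
        simp only [xAt, dite_true, fcast_rfl]
        exact Finsupp.single_eq_of_ne (hb.1 rfl)
      · simp [xAt, h]
    have := incl_proj_apply_of_mem m (v - coefY B n y m v • dxAt B d n x m) ⟨b, hb⟩
    simpa [toCancelled_apply, hx] using this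
  · rw [toCancelled_apply, incl_proj_apply_of_notMem m _ b hb]
    by_cases h : m = n
    · subst h
      obtain rfl : b = y := by
        by_contra hne
        exact hb ⟨fun h => by simp at h, fun _ => hne⟩
      simp [xAt, coefY, dxAt, hxy]
    · by_cases h' : m = n + 1
      · subst h'
        obtain rfl : b = x := by
          by_contra hne
          exact hb ⟨fun _ => hne, fun h'' => absurd h'' h⟩
        simp [xAt, coefX, coefY]
      · exact absurd ⟨fun e => absurd e h', fun e => absurd e h⟩ hb

lemma toCancelled_incl (m : ℤ) (v : Bc B n x y m →₀ ℚ) :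
    toCancelled B d n x y m (incl B n x y m v) = v := by
  simp [toCancelled_apply, coefY_incl, proj_incl]

lemma toCancelled_xAt (m : ℤ) : toCancelled B d n x y m (xAt B n x m) = 0 := by
  simp [toCancelled_apply, coefY_xAt, proj_xAt]

lemma toCancelled_dxAt (hxy : d n (Finsupp.single x 1) y = 1) (m : ℤ) :
    toCancelled B d n x y m (dxAt B d n x m) = 0 := by
  rw [toCancelled_apply, coefY_dxAt_smul_dxAt hxy, sub_self, map_zero]

lemma d_dxAt (hd : ∀ m : ℤ, (d m).comp (d (m + 1)) = 0) (m : ℤ) :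
    d m (dxAt B d n x (m + 1)) = 0 := by
  rw [← d_xAt]
  exact LinearMap.congr_fun (hd m) _

lemma coefYd_dxAt (hd : ∀ m : ℤ, (d m).comp (d (m + 1)) = 0) (m : ℤ) :
    coefYd B d n y m (dxAt B d n x m) = 0 := by
  rw [← d_xAt, coefYd_d hd]

lemma toCancelled_d (hd : ∀ m : ℤ, (d m).comp (d (m + 1)) = 0)
    (hxy : d n (Finsupp.single x 1) y = 1) (m : ℤ) (v : B (m + 1) →₀ ℚ) :
    toCancelled B d n x y m (d m v) = d' B d n x y m (toCancelled B d n x y (m + 1) v) := by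
  simp [d'_apply, incl_toCancelled hxy, d_dxAt hd, d_xAt, toCancelled_dxAt hxy]

lemma ofCancelled_toCancelled (hd : ∀ m : ℤ, (d m).comp (d (m + 1)) = 0)
    (hxy : d n (Finsupp.single x 1) y = 1) (m : ℤ) (v : B m →₀ ℚ) :
    ofCancelled B d n x y m (toCancelled B d n x y m v) =
      v - coefY B n y m v • dxAt B d n x m - coefYd B d n y m v • xAt B n x m := by
  have := congrArg (coefX B n x m v • ·) (coefYd_xAt_smul_xAt (B := B) (d := d) (y := y) hxy m)
  simp only [smul_smul] at this
  simp [ofCancelled_apply, incl_toCancelled hxy, coefYd_dxAt hd, sub_smul, this]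

lemma toCancelled_ofCancelled (m : ℤ) (v : Bc B n x y m →₀ ℚ) :
    toCancelled B d n x y m (ofCancelled B d n x y m v) = v := by
  simp [ofCancelled_apply, toCancelled_incl, toCancelled_xAt]

lemma ofCancelled_d' (hd : ∀ m : ℤ, (d m).comp (d (m + 1)) = 0)
    (hxy : d n (Finsupp.single x 1) y = 1) (m : ℤ) (v : Bc B n x y (m + 1) →₀ ℚ) :
    ofCancelled B d n x y m (d' B d n x y m v) = d m (ofCancelled B d n x y (m + 1) v) := by
  rw [d'_apply, ofCancelled_toCancelled hd hxy, coefYd_d hd, ofCancelled_apply, coefYd_succ]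
  simp [d_xAt]

lemma d'_d' (hd : ∀ m : ℤ, (d m).comp (d (m + 1)) = 0)
    (hxy : d n (Finsupp.single x 1) y = 1) (m : ℤ) (v : Bc B n x y (m + 1 + 1) →₀ ℚ) :
    d' B d n x y m (d' B d n x y (m + 1) v) = 0 := by
  have := LinearMap.congr_fun (hd m) (incl B n x y (m + 1 + 1) v)
  rw [d'_apply (m + 1), ← toCancelled_d hd hxy, ← LinearMap.comp_apply (d m), this,
    LinearMap.zero_apply, map_zero]

variable (B d n x y)

/-- Cancellation (zigzag) lemma: if `(C, d)` is a based chain complex over `ℚ` with distinguished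
finite bases and `x ∈ B_{n+1}`, `y ∈ B_n` are basis elements with `(d x)_y = 1`, then the
cancelled complex `(C′, d′)` is a chain complex and `(C, d)` is chain homotopy equivalent to
`(C′, d′)`. -/
theorem cancellation_lemma
    [∀ m : ℤ, Fintype (B m)]
    (hd : ∀ m : ℤ, (d m).comp (d (m + 1)) = 0)
    (hxy : d n (Finsupp.single x 1) y = 1) :
    (∀ m : ℤ, (d' B d n x y m).comp (d' B d n x y (m + 1)) = 0) ∧
    ∃ (f : ∀ m : ℤ, (B m →₀ ℚ) →ₗ[ℚ] (Bc B n x y m →₀ ℚ))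
      (g : ∀ m : ℤ, (Bc B n x y m →₀ ℚ) →ₗ[ℚ] (B m →₀ ℚ)),
      (∀ m : ℤ, (f m).comp (d m) = (d' B d n x y m).comp (f (m + 1))) ∧
      (∀ m : ℤ, (g m).comp (d' B d n x y m) = (d m).comp (g (m + 1))) ∧
      (∃ h : ∀ m : ℤ, (B m →₀ ℚ) →ₗ[ℚ] (B (m + 1) →₀ ℚ),
        ∀ m : ℤ, (g (m + 1)).comp (f (m + 1)) - LinearMap.id =
          (d (m + 1)).comp (h (m + 1)) + (h m).comp (d m)) ∧
      (∃ h' : ∀ m : ℤ, (Bc B n x y m →₀ ℚ) →ₗ[ℚ] (Bc B n x y (m + 1) →₀ ℚ),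
        ∀ m : ℤ, (f (m + 1)).comp (g (m + 1)) - LinearMap.id =
          (d' B d n x y (m + 1)).comp (h' (m + 1)) + (h' m).comp (d' B d n x y m)) := by
  refine ⟨fun m => LinearMap.ext (d'_d' hd hxy m), toCancelled B d n x y, ofCancelled B d n x y,
    fun m => LinearMap.ext (toCancelled_d hd hxy m),
    fun m => LinearMap.ext (ofCancelled_d' hd hxy m),
    ⟨fun m => -(LinearMap.toSpanSingleton ℚ _ (xAt B n x (m + 1))).comp (coefY B n y m),
      fun m => LinearMap.ext fun v => ?_⟩,
    ⟨fun _ => 0, fun m => LinearMap.ext fun v => ?_⟩⟩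
  · simp only [LinearMap.sub_apply, LinearMap.add_apply, LinearMap.comp_apply, LinearMap.id_apply,
      LinearMap.neg_apply, LinearMap.toSpanSingleton_apply, map_neg, map_smul, d_xAt,
      ofCancelled_toCancelled hd hxy, coefYd_succ]
    abel
  · simp [toCancelled_ofCancelled]
end
end

section
/- Sign identity for reordered wedge generators: Let n ≥ 1 and let π be a permutation of {1,…,n}. Then for every subset J ⊆ {1,…,n} and every x ∈ {1,…,n} \ J, one has σ_π(J ∪ {x}) = (−1)^{p+q} · σ_π(J), where p = #{ j ∈ J : j < x } and q = #{ j ∈ J : π(j) < π(x) }. -/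
noncomputable section

/-- For a permutation `π` of `Fin n` and a subset `S` with elements `s₁ < … < s_k` listed in
increasing order, `sgnSort π S ∈ {±1}` is the sign of the permutation of `k` letters that sorts
the list `(π s₁, …, π s_k)` into increasing order; it equals `(-1)` raised to the number of
inversions, i.e. pairs `a < b` in `S` with `π b < π a`.  In particular `sgnSort π ∅ = 1`. -/
def sgnSort {n : ℕ} (π : Equiv.Perm (Fin n)) (S : Finset (Fin n)) : ℚ :=
  (-1 : ℚ) ^ ((S ×ˢ S).filter fun p => p.1 < p.2 ∧ π p.2 < π p.1).card

/-- Sign identity for reordered wedge generators: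
`σ_π(J ∪ {x}) = (−1)^{p+q} · σ_π(J)` where `p = #{ j ∈ J : j < x }` and
`q = #{ j ∈ J : π(j) < π(x) }`. -/
theorem sgnSort_insert {n : ℕ} (hn : 1 ≤ n) (π : Equiv.Perm (Fin n))
    (J : Finset (Fin n)) (x : Fin n) (hx : x ∉ J) :
    sgnSort π (insert x J) =
      (-1 : ℚ) ^ ((J.filter fun j => j < x).card + (J.filter fun j => π j < π x).card) *
        sgnSort π J := by
  have key : (-1 : ℚ) ^ ((∑ j ∈ J, if x < j ∧ π j < π x then 1 else 0) +
      ∑ j ∈ J, if j < x ∧ π x < π j then 1 else 0) =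
      (-1 : ℚ) ^ ((∑ j ∈ J, if j < x then 1 else 0) + ∑ j ∈ J, if π j < π x then 1 else 0) := by
    simp only [← Finset.sum_add_distrib, ← Finset.prod_pow_eq_pow_sum]
    refine Finset.prod_congr rfl fun j hj => ?_
    have hjx : j ≠ x := ne_of_mem_of_not_mem hj hx
    rcases lt_or_gt_of_ne hjx with h | h <;>
      rcases lt_or_gt_of_ne (π.injective.ne hjx) with h' | h' <;>
      simp [h, h', h.not_gt, h'.not_gt]
  unfold sgnSort
  simp only [Finset.card_filter, Finset.sum_product]
  rw [← key, ← pow_add]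
  simp only [Finset.sum_insert hx, Finset.sum_add_distrib, lt_self_iff_false, false_and,
    if_false, zero_add]
  rw [add_assoc]
end
end
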